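/- arXiv:1512.04856 — 2 statements merged into one kernel-verified Lean document; each statement's English description precedes it below -/
import Mathlib

section
/- Let d ≥ 1, let P ⊂ ℝ^d be a finite set of points, q ∈ ℝ^d, and suppose P ∪ {q} is in general position. Then for every nonempty subset A ⊆ P, we have |A| · σ_P(q) ≥ |P| · σ_A(q), i.e., the simplicial depth of q with respect to P is at least (|P|/|A|) times the simplicial depth of q with respect to A. -/
/-- The simplicial depth of `q` with respect to a finite point set `P` in `ℝ^d`:
the number of `(d+1)`-element subsets of `P` whose convex hull contains `q`. -/
noncomputable def simplicialDepth (d : ℕ) (P : Finset (EuclideanSpace ℝ (Fin d)))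
    (q : EuclideanSpace ℝ (Fin d)) : ℕ :=
  {S : Finset (EuclideanSpace ℝ (Fin d)) |
    S ⊆ P ∧ S.card = d + 1 ∧ q ∈ convexHull ℝ (S : Set (EuclideanSpace ℝ (Fin d)))}.ncard

/-- A set `X ⊆ ℝ^d` is in general position if every subset of at most `d+1` of its
points is affinely independent. -/
def InGeneralPosition (d : ℕ) (X : Set (EuclideanSpace ℝ (Fin d))) : Prop :=
  ∀ S : Finset (EuclideanSpace ℝ (Fin d)), ↑S ⊆ X → S.card ≤ d + 1 →
    AffineIndependent ℝ (fun x : S => (x : EuclideanSpace ℝ (Fin d)))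

open Finset in
/-- Carathéodory exchange: a point `p` can replace some vertex of a `(d+1)`-point set while
keeping `q` in the convex hull. -/
theorem exists_mem_convexHull_insert_erase {d : ℕ} [DecidableEq (EuclideanSpace ℝ (Fin d))]
    {S : Finset (EuclideanSpace ℝ (Fin d))} {p q : EuclideanSpace ℝ (Fin d)}
    (hcard : S.card = d + 1) (hp : p ∉ S)
    (hq : q ∈ convexHull ℝ (S : Set (EuclideanSpace ℝ (Fin d)))) :
    ∃ s ∈ S, q ∈ convexHull ℝ
      ((insert p (S.erase s) : Finset (EuclideanSpace ℝ (Fin d))) :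
        Set (EuclideanSpace ℝ (Fin d))) := by
  obtain ⟨f, hf, hfsum, x, hx, hfx, hfp⟩ : ∃ f : EuclideanSpace ℝ (Fin d) → ℝ,
      ∑ e ∈ insert p S, f e • e = 0 ∧ ∑ e ∈ insert p S, f e = 0 ∧
        ∃ x ∈ insert p S, f x ≠ 0 ∧ f p ≤ 0 := by
    obtain ⟨f, hf, hfsum, x, hx, hfx⟩ :=
      Module.exists_nontrivial_relation_sum_zero_of_finrank_succ_lt_card
        (R := ℝ) (t := insert p S) (by simp [card_insert_of_notMem hp, hcard])
    rcases le_total (f p) 0 with h | h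
    · exact ⟨f, hf, hfsum, x, hx, hfx, h⟩
    · exact ⟨fun e => -f e, by simp [hf], by simp [hfsum], x, hx, by simpa using hfx,
        by simpa using h⟩
  obtain ⟨w, hw, hwsum, hwq⟩ :=
    mem_convexHull'.1 (convexHull_mono (coe_subset.2 (subset_insert p S)) hq)
  obtain ⟨y, hy, hfy⟩ := exists_pos_of_sum_zero_of_exists_nonzero f hfsum ⟨x, hx, hfx⟩
  obtain ⟨s, hs, hmin⟩ := exists_min_image {e ∈ insert p S | 0 < f e} (fun e => w e / f e)
    ⟨y, mem_filter.2 ⟨hy, hfy⟩⟩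
  obtain ⟨hsT, hfs⟩ := mem_filter.1 hs
  have hsp : s ≠ p := by
    rintro rfl
    exact absurd hfs (not_lt.2 hfp)
  set t := w s / f s with ht
  have ht0 : 0 ≤ t := div_nonneg (hw s hsT) hfs.le
  have hzero : w s - t * f s = 0 := by
    rw [ht, div_mul_cancel₀ _ hfs.ne', sub_self]
  refine ⟨s, mem_of_mem_insert_of_ne hsT hsp, ?_⟩
  rw [← erase_insert_of_ne hsp.symm]
  refine mem_convexHull'.2 ⟨fun e => w e - t * f e, fun e he => ?_, ?_, ?_⟩ <;> beta_reduce
  · have heT := mem_of_mem_erase he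
    rcases le_or_gt (f e) 0 with h | h
    · exact sub_nonneg.2 ((mul_nonpos_of_nonneg_of_nonpos ht0 h).trans (hw e heT))
    · exact sub_nonneg.2 ((le_div_iff₀ h).1 (hmin e (mem_filter.2 ⟨heT, h⟩)))
  · rw [sum_erase (f := fun e => w e - t * f e) _ hzero, sum_sub_distrib, ← mul_sum, hfsum, hwsum, mul_zero, sub_zero]
  · rw [sum_erase (f := fun e => (w e - t * f e) • e) _ (by beta_reduce; rw [hzero, zero_smul])]
    simp only [sub_smul, mul_smul]
    rw [sum_sub_distrib, ← smul_sum, hf, hwq, smul_zero, sub_zero]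

open Classical Finset in
/-- Simplicial depth as the cardinality of a filtered finset. -/
theorem simplicialDepth_eq_card_filter (d : ℕ) (P : Finset (EuclideanSpace ℝ (Fin d)))
    (q : EuclideanSpace ℝ (Fin d)) :
    simplicialDepth d P q = #({S ∈ powersetCard (d + 1) P |
      q ∈ convexHull ℝ (S : Set (EuclideanSpace ℝ (Fin d)))} :
        Finset (Finset (EuclideanSpace ℝ (Fin d)))) := by
  rw [simplicialDepth, ← Set.ncard_coe_finset]
  congr 1
  ext S
  simp [mem_powersetCard, and_assoc]

open Classical Finset in
/-- The ratio inequality for adding a single point. -/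
theorem card_succ_mul_simplicialDepth_le {d : ℕ} {B : Finset (EuclideanSpace ℝ (Fin d))}
    {p : EuclideanSpace ℝ (Fin d)} (hp : p ∉ B) (q : EuclideanSpace ℝ (Fin d)) :
    (B.card + 1) * simplicialDepth d B q ≤ B.card * simplicialDepth d (insert p B) q := by
  set F : Finset (Finset (EuclideanSpace ℝ (Fin d))) := {S ∈ powersetCard (d + 1) (insert p B) |
    q ∈ convexHull ℝ (S : Set (EuclideanSpace ℝ (Fin d)))} with hF
  set G : Finset (Finset (EuclideanSpace ℝ (Fin d))) := {S ∈ powersetCard (d + 1) B |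
    q ∈ convexHull ℝ (S : Set (EuclideanSpace ℝ (Fin d)))} with hG
  have hGF : {S ∈ F | p ∉ S} = G := by
    ext S
    simp only [hF, hG, mem_filter, mem_powersetCard]
    constructor
    · rintro ⟨⟨⟨hS, hc⟩, hq⟩, hpS⟩
      exact ⟨⟨(subset_insert_iff_of_notMem hpS).1 hS, hc⟩, hq⟩
    · rintro ⟨⟨hS, hc⟩, hq⟩
      exact ⟨⟨⟨hS.trans (subset_insert p B), hc⟩, hq⟩, fun h => hp (hS h)⟩
  have hsplit : #{S ∈ F | p ∈ S} + #G = #F := by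
    rw [← hGF]
    exact card_filter_add_card_filter_not _
  have hexch : ∀ S ∈ G, ∃ s ∈ S, insert p (S.erase s) ∈ F := by
    intro S hS
    obtain ⟨hSB, hq⟩ := mem_filter.1 hS
    obtain ⟨hSB, hc⟩ := mem_powersetCard.1 hSB
    have hpS : p ∉ S := fun h => hp (hSB h)
    obtain ⟨s, hs, hqs⟩ := exists_mem_convexHull_insert_erase hc hpS hq
    refine ⟨s, hs, mem_filter.2 ⟨mem_powersetCard.2
      ⟨insert_subset_insert p ((erase_subset s S).trans hSB), ?_⟩, hqs⟩⟩
    rw [card_insert_of_notMem fun h => hpS (mem_of_mem_erase h), card_erase_add_one hs, hc]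
  choose! v hv hvF using hexch
  have hsub : ∀ S ∈ G, S ⊆ B := fun S hS => (mem_powersetCard.1 (mem_filter.1 hS).1).1
  have hrec : ∀ S ∈ G, insert (v S) ((insert p (S.erase (v S))).erase p) = S := by
    intro S hS
    rw [erase_insert fun h => hp (hsub S hS (mem_of_mem_erase h)), insert_erase (hv S hS)]
  have hle : #G ≤ #({S ∈ F | p ∈ S} ×ˢ B) := by
    refine card_le_card_of_injOn (fun S => (insert p (S.erase (v S)), v S)) ?_ ?_
    · intro S hS
      exact mem_product.2 ⟨mem_filter.2 ⟨hvF S hS, mem_insert_self _ _⟩, hsub S hS (hv S hS)⟩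
    · intro S hS T hT h
      obtain ⟨h₁, h₂⟩ := Prod.mk.inj h
      rw [← hrec S hS, ← hrec T hT, h₁, h₂]
  rw [card_product] at hle
  rw [simplicialDepth_eq_card_filter, simplicialDepth_eq_card_filter, ← hF, ← hG, ← hsplit]
  linarith

/-- for every nonempty `A ⊆ P` (with `P ∪ {q}` in general position),
`|A| · σ_P(q) ≥ |P| · σ_A(q)`. -/
theorem simplicialDepth_subset_ratio (d : ℕ) (hd : 1 ≤ d)
    (P : Finset (EuclideanSpace ℝ (Fin d))) (q : EuclideanSpace ℝ (Fin d))
    (hgp : InGeneralPosition d (↑P ∪ {q}))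
    (A : Finset (EuclideanSpace ℝ (Fin d))) (hAP : A ⊆ P) (hA : A.Nonempty) :
    P.card * simplicialDepth d A q ≤ A.card * simplicialDepth d P q := by
  classical
  suffices h : ∀ D : Finset (EuclideanSpace ℝ (Fin d)),
      (A ∪ D).card * simplicialDepth d A q ≤ A.card * simplicialDepth d (A ∪ D) q by
    simpa only [Finset.union_eq_right.2 hAP] using h P
  intro D
  induction D using Finset.induction_on with
  | empty => simp
  | insert p D _ ih =>
    rw [Finset.union_insert]
    by_cases hp : p ∈ A ∪ D
    · rwa [Finset.insert_eq_of_mem hp]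
    · have hstep := card_succ_mul_simplicialDepth_le hp q
      have hpos : 0 < (A ∪ D).card := (hA.mono Finset.subset_union_left).card_pos
      rw [Finset.card_insert_of_notMem hp]
      refine Nat.le_of_mul_le_mul_left ?_ hpos
      calc (A ∪ D).card * (((A ∪ D).card + 1) * simplicialDepth d A q)
          = ((A ∪ D).card + 1) * ((A ∪ D).card * simplicialDepth d A q) := by ring
        _ ≤ ((A ∪ D).card + 1) * (A.card * simplicialDepth d (A ∪ D) q) := by gcongr
        _ = A.card * (((A ∪ D).card + 1) * simplicialDepth d (A ∪ D) q) := by ring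
        _ ≤ A.card * ((A ∪ D).card * simplicialDepth d (insert p (A ∪ D)) q) := by gcongr
        _ = (A ∪ D).card * (A.card * simplicialDepth d (insert p (A ∪ D)) q) := by ring
end

section
/- Let d ≥ 1 and let P ⊂ ℝ^d be a finite set of n points. Define P̃ = {(p, 1) : p ∈ P} ⊂ ℝ^{d+1}, let e denote the (d+1)-st standard basis vector of ℝ^{d+1}, and let Q = P̃ ∪ {−e, 2e} (so |Q| = n + 2). Then the simplicial depths satisfy σ_Q(0) = σ_P(0) + C(n, d), where σ_Q(0) counts the (d+2)-element subsets of Q ⊂ ℝ^{d+1} containing the origin in their convex hull, σ_P(0) counts the (d+1)-element subsets of P ⊂ ℝ^d containing the origin in their convex hull, and C(n,d) is the binomial coefficient n choose d. -/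
open scoped Classical

/-- The lift `ℝ^d → ℝ^{d+1}` appending a last coordinate equal to `1`. -/
noncomputable def liftOne (d : ℕ) (p : EuclideanSpace ℝ (Fin d)) :
    EuclideanSpace ℝ (Fin (d + 1)) :=
  (EuclideanSpace.equiv (Fin (d + 1)) ℝ).symm
    (Fin.snoc (EuclideanSpace.equiv (Fin d) ℝ p) 1)

@[simp] theorem liftOne_castSucc {d : ℕ} (p : EuclideanSpace ℝ (Fin d)) (i : Fin d) :
    liftOne d p i.castSucc = p i := by
  simp [liftOne]

@[simp] theorem liftOne_last {d : ℕ} (p : EuclideanSpace ℝ (Fin d)) :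
    liftOne d p (Fin.last d) = 1 := by
  simp [liftOne]

theorem liftOne_injective (d : ℕ) : Function.Injective (liftOne d) := by
  intro p q h
  ext i
  simpa using congrArg (fun v => v.ofLp i.castSucc) h

/-- The lift `p ↦ (p, 1)` as an affine map. -/
noncomputable def liftOneAffine (d : ℕ) :
    EuclideanSpace ℝ (Fin d) →ᵃ[ℝ] EuclideanSpace ℝ (Fin (d + 1)) where
  toFun := liftOne d
  linear :=
    { toFun := fun p => liftOne d p - liftOne d 0
      map_add' := fun p q => by
        ext i
        induction i using Fin.lastCases <;> simp
      map_smul' := fun c p => by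
        ext i
        induction i using Fin.lastCases <;> simp }
  map_vadd' := fun p v => by
    ext i
    induction i using Fin.lastCases <;> simp

theorem convexHull_image_liftOne {d : ℕ} (T : Set (EuclideanSpace ℝ (Fin d))) :
    convexHull ℝ (liftOne d '' T) = liftOne d '' convexHull ℝ T :=
  ((liftOneAffine d).image_convexHull T).symm

theorem zero_mem_convexHull_insert_neg_single_liftOne {d : ℕ}
    {T : Set (EuclideanSpace ℝ (Fin d))} (hT : T.Nonempty) :
    0 ∈ convexHull ℝ (insert (-EuclideanSpace.single (Fin.last d) (1 : ℝ)) (liftOne d '' T)) ↔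
      0 ∈ convexHull ℝ T := by
  rw [convexHull_insert (hT.image _), convexHull_image_liftOne, mem_convexJoin]
  simp only [Set.mem_singleton_iff, exists_eq_left, Set.exists_mem_image]
  constructor
  · rintro ⟨x, hx, a, b, -, -, hab, h⟩
    have hlast := congrArg (fun v => v.ofLp (Fin.last d)) h
    simp only [PiLp.add_apply, PiLp.smul_apply, PiLp.neg_apply, PiLp.zero_apply, liftOne_last,
      PiLp.single_apply, if_true, smul_eq_mul] at hlast
    have hb : b ≠ 0 := by
      rintro rfl
      linarith
    suffices x = 0 by rwa [this] at hx
    ext i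
    have hi := congrArg (fun v => v.ofLp i.castSucc) h
    simpa [hb, Fin.castSucc_ne_last] using hi
  · intro h
    refine ⟨0, h, 1 / 2, 1 / 2, by norm_num, by norm_num, by norm_num, ?_⟩
    ext i
    induction i using Fin.lastCases <;> simp [Fin.castSucc_ne_last]

theorem zero_mem_convexHull_of_neg_of_two_smul {E : Type*} [AddCommGroup E] [Module ℝ E]
    {s : Set E} {e : E} (h₁ : -e ∈ s) (h₂ : (2 : ℝ) • e ∈ s) : 0 ∈ convexHull ℝ s := by
  refine segment_subset_convexHull h₁ h₂
    ⟨2 / 3, 1 / 3, by norm_num, by norm_num, by norm_num, ?_⟩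
  module

theorem zero_notMem_convexHull_of_forall_pos {ι : Type*}
    {s : Set (EuclideanSpace ℝ ι)} (i : ι) (h : ∀ v ∈ s, 0 < v i) :
    0 ∉ convexHull ℝ s := by
  intro h0
  have hconv : Convex ℝ {v : EuclideanSpace ℝ ι | 0 < v i} :=
    convex_halfSpace_gt ⟨fun _ _ => rfl, fun _ _ => rfl⟩ 0
  exact lt_irrefl (0 : ℝ) (convexHull_min h hconv h0)

/-- with `P̃ = {(p,1) : p ∈ P}`, `e` the `(d+1)`-st standard basis
vector, and `Q = P̃ ∪ {−e, 2e}`, we have `σ_Q(0) = σ_P(0) + C(n,d)`. -/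
theorem simplicialDepth_lift_plus_binom (d : ℕ) (hd : 1 ≤ d)
    (P : Finset (EuclideanSpace ℝ (Fin d))) (n : ℕ) (hn : P.card = n)
    (e : EuclideanSpace ℝ (Fin (d + 1)))
    (he : e = EuclideanSpace.single (Fin.last d) (1 : ℝ))
    (Q : Finset (EuclideanSpace ℝ (Fin (d + 1))))
    (hQ : Q = P.image (liftOne d) ∪ {-e, (2 : ℝ) • e}) :
    simplicialDepth (d + 1) Q 0 = simplicialDepth d P 0 + n.choose d := by
  subst hn
  have elast : e (Fin.last d) = 1 := by simp [he]
  have mem_Q (v : EuclideanSpace ℝ (Fin (d + 1))) :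
      v ∈ Q ↔ v ∈ P.image (liftOne d) ∨ v = -e ∨ v = (2 : ℝ) • e := by
    rw [hQ, Finset.mem_union, Finset.mem_insert, Finset.mem_singleton]
  have neg_notMem (T : Finset (EuclideanSpace ℝ (Fin d))) : -e ∉ T.image (liftOne d) := by
    rw [Finset.mem_image]
    rintro ⟨p, -, hp⟩
    have := congrArg (fun v => v.ofLp (Fin.last d)) hp
    norm_num [elast] at this
  have two_notMem (T : Finset (EuclideanSpace ℝ (Fin d))) :
      (2 : ℝ) • e ∉ T.image (liftOne d) := by
    rw [Finset.mem_image]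
    rintro ⟨p, -, hp⟩
    have := congrArg (fun v => v.ofLp (Fin.last d)) hp
    norm_num [elast] at this
  have neg_ne_two : -e ≠ (2 : ℝ) • e := by
    intro h
    have := congrArg (fun v => v.ofLp (Fin.last d)) h
    norm_num [elast] at this
  have neg_notMem' (T : Finset (EuclideanSpace ℝ (Fin d))) :
      -e ∉ insert ((2 : ℝ) • e) (T.image (liftOne d)) := by
    simp only [Finset.mem_insert, not_or]
    exact ⟨neg_ne_two, neg_notMem T⟩
  have card_lift (T : Finset (EuclideanSpace ℝ (Fin d))) : (T.image (liftOne d)).card = T.card :=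
    Finset.card_image_of_injective _ (liftOne_injective d)
  have lift_subset {T : Finset (EuclideanSpace ℝ (Fin d))} (hT : T ⊆ P) :
      T.image (liftOne d) ⊆ Q := fun v hv =>
    (mem_Q v).2 (.inl (Finset.image_subset_image hT hv))
  have lift_inj := Finset.image_injective (liftOne_injective d)
  let f (T : Finset (EuclideanSpace ℝ (Fin d))) := insert (-e) (T.image (liftOne d))
  let g (T : Finset (EuclideanSpace ℝ (Fin d))) :=
    insert (-e) (insert ((2 : ℝ) • e) (T.image (liftOne d)))
  have f_inj : Function.Injective f := fun T U h => lift_inj <| by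
    rw [← Finset.erase_insert (neg_notMem T), ← Finset.erase_insert (neg_notMem U)]
    exact congrArg (Finset.erase · (-e)) h
  have g_inj : Function.Injective g := fun T U h => lift_inj <| by
    rw [← Finset.erase_insert (two_notMem T), ← Finset.erase_insert (two_notMem U),
      ← Finset.erase_insert (neg_notMem' T), ← Finset.erase_insert (neg_notMem' U)]
    exact congrArg (fun S => (Finset.erase S (-e)).erase ((2 : ℝ) • e)) h
  have f_mem {T : Finset (EuclideanSpace ℝ (Fin d))} (hT : T.card = d + 1) :
      0 ∈ convexHull ℝ (f T : Set (EuclideanSpace ℝ (Fin (d + 1)))) ↔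
        0 ∈ convexHull ℝ (T : Set (EuclideanSpace ℝ (Fin d))) := by
    simp only [f, he, Finset.coe_insert, Finset.coe_image]
    exact zero_mem_convexHull_insert_neg_single_liftOne
      (Finset.coe_nonempty.2 (Finset.card_pos.1 (by omega)))
  have decomposition :
      {S : Finset (EuclideanSpace ℝ (Fin (d + 1))) | S ⊆ Q ∧ S.card = d + 1 + 1 ∧
        0 ∈ convexHull ℝ (S : Set (EuclideanSpace ℝ (Fin (d + 1))))} =
      f '' {T | T ⊆ P ∧ T.card = d + 1 ∧
        0 ∈ convexHull ℝ (T : Set (EuclideanSpace ℝ (Fin d)))} ∪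
      g '' (P.powersetCard d : Set (Finset (EuclideanSpace ℝ (Fin d)))) := by
    ext S
    constructor
    · rintro ⟨hSQ, hcard, h0⟩
      have hneg : -e ∈ S := by
        by_contra hneg
        refine zero_notMem_convexHull_of_forall_pos (Fin.last d) (fun v hv => ?_) h0
        rcases (mem_Q v).1 (hSQ hv) with h | rfl | rfl
        · obtain ⟨p, -, rfl⟩ := Finset.mem_image.1 h
          simp
        · exact absurd hv hneg
        · simp [elast]
      by_cases htwo : (2 : ℝ) • e ∈ S
      · right
        have hsub : (S.erase (-e)).erase ((2 : ℝ) • e) ⊆ P.image (liftOne d) := by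
          intro v hv
          simp only [Finset.mem_erase] at hv
          exact ((mem_Q v).1 (hSQ hv.2.2)).resolve_right (not_or.2 ⟨hv.2.1, hv.1⟩)
        obtain ⟨T, hTP, hT⟩ := Finset.subset_image_iff.1 hsub
        have hgT : g T = S := by
          simp only [g, hT]
          rw [Finset.insert_erase (Finset.mem_erase.2 ⟨neg_ne_two.symm, htwo⟩),
            Finset.insert_erase hneg]
        refine ⟨T, Finset.mem_coe.2 (Finset.mem_powersetCard.2 ⟨hTP, ?_⟩), hgT⟩
        rw [← hgT, Finset.card_insert_of_notMem (neg_notMem' T),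
          Finset.card_insert_of_notMem (two_notMem T), card_lift] at hcard
        omega
      · left
        have hsub : S.erase (-e) ⊆ P.image (liftOne d) := by
          intro v hv
          obtain ⟨hv_ne, hvS⟩ := Finset.mem_erase.1 hv
          exact ((mem_Q v).1 (hSQ hvS)).resolve_right
            (not_or.2 ⟨hv_ne, fun h => htwo (h ▸ hvS)⟩)
        obtain ⟨T, hTP, hT⟩ := Finset.subset_image_iff.1 hsub
        have hfT : f T = S := by
          simp only [f, hT]
          rw [Finset.insert_erase hneg]
        have hTcard : T.card = d + 1 := by
          rw [← hfT, Finset.card_insert_of_notMem (neg_notMem T), card_lift] at hcard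
          omega
        exact ⟨T, ⟨hTP, hTcard, (f_mem hTcard).1 (hfT ▸ h0)⟩, hfT⟩
    · rintro (⟨T, ⟨hTP, hcard, h0⟩, rfl⟩ | ⟨T, hT, rfl⟩)
      · refine ⟨?_, ?_, (f_mem hcard).2 h0⟩
        · exact Finset.insert_subset ((mem_Q _).2 (.inr (.inl rfl))) (lift_subset hTP)
        · rw [Finset.card_insert_of_notMem (neg_notMem T), card_lift, hcard]
      · obtain ⟨hTP, hcard⟩ := Finset.mem_powersetCard.1 (Finset.mem_coe.1 hT)
        refine ⟨?_, ?_, zero_mem_convexHull_of_neg_of_two_smul (e := e) ?_ ?_⟩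
        · exact Finset.insert_subset ((mem_Q _).2 (.inr (.inl rfl)))
            (Finset.insert_subset ((mem_Q _).2 (.inr (.inr rfl))) (lift_subset hTP))
        · rw [Finset.card_insert_of_notMem (neg_notMem' T),
            Finset.card_insert_of_notMem (two_notMem T), card_lift, hcard]
        · simp [g]
        · simp [g]
  have disjoint : Disjoint
      (f '' {T | T ⊆ P ∧ T.card = d + 1 ∧
        0 ∈ convexHull ℝ (T : Set (EuclideanSpace ℝ (Fin d)))})
      (g '' (P.powersetCard d : Set (Finset (EuclideanSpace ℝ (Fin d))))) := by
    rw [Set.disjoint_left]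
    rintro _ ⟨T, -, rfl⟩ ⟨U, -, hU⟩
    have h : (2 : ℝ) • e ∈ f T := hU ▸ by simp [g]
    rcases Finset.mem_insert.1 h with h | h
    · exact neg_ne_two h.symm
    · exact two_notMem T h
  have finite : {T | T ⊆ P ∧ T.card = d + 1 ∧
      0 ∈ convexHull ℝ (T : Set (EuclideanSpace ℝ (Fin d)))}.Finite :=
    P.powerset.finite_toSet.subset fun T hT => by simpa using hT.1
  unfold simplicialDepth
  rw [decomposition, Set.ncard_union_eq disjoint (finite.image f)
    ((Finset.finite_toSet _).image g), Set.ncard_image_of_injective _ f_inj,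
    Set.ncard_image_of_injective _ g_inj, Set.ncard_coe_finset, Finset.card_powersetCard]
end
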